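/- arXiv:2506.22896 — 17 statements merged into one kernel-verified Lean document; each statement's English description precedes it below -/
import Mathlib

section
/- Let U ⊆ ℂ be a nonempty open set and let q : ℂ → ℂ be twice differentiable on U with q''(x) = 6q(x)² + x for all x ∈ U. Suppose y, z : ℂ → ℂ are differentiable on U and satisfy system IX.B(5) with coefficient q on U, i.e. y' = −y² + z + 3q and z' = 4y·z − 9q'. Then the functions Y := −2y and Z := −2(z − 3y² + 9q) are differentiable on U and satisfy system IX.B(2) with coefficient q on U, i.e. Y' = −Y² + Z + 12q and Z' = Y·Z. -/
/-- Solutions of system IX.B(5) with P_I coefficient q map to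
solutions of system IX.B(2) via Y = -2y, Z = -2(z - 3y² + 9q). -/
theorem systemIXB5_to_systemIXB2
    (U : Set ℂ) (hU : IsOpen U) (hne : U.Nonempty)
    (q q' : ℂ → ℂ)
    (hq : ∀ x ∈ U, HasDerivAt q (q' x) x)
    (hq' : ∀ x ∈ U, HasDerivAt q' (6 * q x ^ 2 + x) x)
    (y z : ℂ → ℂ)
    (hy : ∀ x ∈ U, HasDerivAt y (-(y x) ^ 2 + z x + 3 * q x) x)
    (hz : ∀ x ∈ U, HasDerivAt z (4 * y x * z x - 9 * q' x) x) :
    ∀ x ∈ U,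
      HasDerivAt (fun s => -2 * y s)
        (-(-2 * y x) ^ 2 + (-2 * (z x - 3 * y x ^ 2 + 9 * q x)) + 12 * q x) x ∧
      HasDerivAt (fun s => -2 * (z s - 3 * y s ^ 2 + 9 * q s))
        ((-2 * y x) * (-2 * (z x - 3 * y x ^ 2 + 9 * q x))) x := by
  intro x hx
  constructor
  · exact ((hy x hx).const_mul (-2)).congr_deriv (by ring)
  · exact ((((hz x hx).fun_sub (((hy x hx).fun_pow 2).const_mul 3)).fun_add
      ((hq x hx).const_mul 9)).const_mul (-2)).congr_deriv (by push_cast; ring)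
end

section
/- Let U ⊆ ℂ be a nonempty open set and let q : ℂ → ℂ be twice differentiable on U with q''(x) = 6q(x)² + x for all x ∈ U. Suppose Y, Z : ℂ → ℂ are differentiable on U and satisfy system IX.B(2) with coefficient q on U, i.e. Y' = −Y² + Z + 12q and Z' = Y·Z. Then the functions y := −Y/2 and z := −Z/2 + 3Y²/4 − 9q are differentiable on U and satisfy system IX.B(5) with coefficient q on U, i.e. y' = −y² + z + 3q and z' = 4y·z − 9q'. -/
/-- Solutions of system IX.B(2) with P_I coefficient q map to
solutions of system IX.B(5) via y = -Y/2, z = -Z/2 + 3Y²/4 - 9q. -/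
theorem systemIXB2_to_systemIXB5
    (U : Set ℂ) (hU : IsOpen U) (hne : U.Nonempty)
    (q q' : ℂ → ℂ)
    (hq : ∀ x ∈ U, HasDerivAt q (q' x) x)
    (hq' : ∀ x ∈ U, HasDerivAt q' (6 * q x ^ 2 + x) x)
    (Y Z : ℂ → ℂ)
    (hY : ∀ x ∈ U, HasDerivAt Y (-(Y x) ^ 2 + Z x + 12 * q x) x)
    (hZ : ∀ x ∈ U, HasDerivAt Z (Y x * Z x) x) :
    ∀ x ∈ U,
      HasDerivAt (fun s => -(Y s) / 2)
        (-(-(Y x) / 2) ^ 2 + (-(Z x) / 2 + 3 * Y x ^ 2 / 4 - 9 * q x) + 3 * q x) x ∧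
      HasDerivAt (fun s => -(Z s) / 2 + 3 * Y s ^ 2 / 4 - 9 * q s)
        (4 * (-(Y x) / 2) * (-(Z x) / 2 + 3 * Y x ^ 2 / 4 - 9 * q x) - 9 * q' x) x := by
  intro x hx
  constructor
  · refine ((hY x hx).fun_neg.div_const 2).congr_deriv ?_
    ring
  · refine ((((hZ x hx).fun_neg.div_const 2).fun_add
      ((((hY x hx).fun_pow 2).const_mul 3).div_const 4)).fun_sub
      ((hq x hx).const_mul 9)).congr_deriv ?_
    push_cast
    ring
end

section
/- Let U ⊆ ℂ be a nonempty open set and let q : ℂ → ℂ be twice differentiable on U with q''(x) = 6q(x)² + x for all x ∈ U. Suppose y, z : ℂ → ℂ are differentiable on U, satisfy system V on U, i.e. y' = z and z' = 6y² + x, and that y(x) ≠ q(x) for every x ∈ U. Then the functions Z := 6(y − q) and Y := (z − q')/(y − q) are differentiable on U and satisfy system IX.B(2) with coefficient q on U, i.e. Y' = −Y² + Z + 12q and Z' = Y·Z. -/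
/-- Solutions of system V (with y ≠ q on U) map to solutions of
system IX.B(2) via Z = 6(y - q), Y = (z - q')/(y - q). -/
theorem systemV_to_systemIXB2
    (U : Set ℂ) (hU : IsOpen U) (hne : U.Nonempty)
    (q q' : ℂ → ℂ)
    (hq : ∀ x ∈ U, HasDerivAt q (q' x) x)
    (hq' : ∀ x ∈ U, HasDerivAt q' (6 * q x ^ 2 + x) x)
    (y z : ℂ → ℂ)
    (hy : ∀ x ∈ U, HasDerivAt y (z x) x)
    (hz : ∀ x ∈ U, HasDerivAt z (6 * y x ^ 2 + x) x)
    (hne' : ∀ x ∈ U, y x ≠ q x) :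
    ∀ x ∈ U,
      HasDerivAt (fun s => (z s - q' s) / (y s - q s))
        (-((z x - q' x) / (y x - q x)) ^ 2 + 6 * (y x - q x) + 12 * q x) x ∧
      HasDerivAt (fun s => 6 * (y s - q s))
        (((z x - q' x) / (y x - q x)) * (6 * (y x - q x))) x := by
  intro x hx
  have hd : y x - q x ≠ 0 := sub_ne_zero.mpr (hne' x hx)
  have hyq : HasDerivAt (fun s => y s - q s) (z x - q' x) x := (hy x hx).sub (hq x hx)
  have hzq : HasDerivAt (fun s => z s - q' s) (6 * y x ^ 2 + x - (6 * q x ^ 2 + x)) x :=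
    (hz x hx).sub (hq' x hx)
  constructor
  · refine (hzq.fun_div hyq hd).congr_deriv ?_
    field_simp
    ring
  · refine (hyq.const_mul 6).congr_deriv ?_
    field_simp
end

section
/- Let U ⊆ ℂ be a nonempty open set and let q : ℂ → ℂ be twice differentiable on U with q''(x) = 6q(x)² + x for all x ∈ U. Suppose Y, Z : ℂ → ℂ are differentiable on U and satisfy system IX.B(2) with coefficient q on U, i.e. Y' = −Y² + Z + 12q and Z' = Y·Z. Then the functions y := Z/6 + q and z := Y·Z/6 + q' are differentiable on U and satisfy system V on U, i.e. y' = z and z' = 6y² + x. -/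
/-- Solutions of system IX.B(2) with P_I coefficient q map to
solutions of system V via y = Z/6 + q, z = Y·Z/6 + q'. -/
theorem systemIXB2_to_systemV
    (U : Set ℂ) (hU : IsOpen U) (hne : U.Nonempty)
    (q q' : ℂ → ℂ)
    (hq : ∀ x ∈ U, HasDerivAt q (q' x) x)
    (hq' : ∀ x ∈ U, HasDerivAt q' (6 * q x ^ 2 + x) x)
    (Y Z : ℂ → ℂ)
    (hY : ∀ x ∈ U, HasDerivAt Y (-(Y x) ^ 2 + Z x + 12 * q x) x)
    (hZ : ∀ x ∈ U, HasDerivAt Z (Y x * Z x) x) :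
    ∀ x ∈ U,
      HasDerivAt (fun s => Z s / 6 + q s) (Y x * Z x / 6 + q' x) x ∧
      HasDerivAt (fun s => Y s * Z s / 6 + q' s) (6 * (Z x / 6 + q x) ^ 2 + x) x := by
  intro x hx
  refine ⟨((hZ x hx).div_const 6).add (hq x hx), ?_⟩
  have h := (((hY x hx).mul (hZ x hx)).div_const 6).add (hq' x hx)
  exact h.congr_deriv (by ring)
end

section
/- Fix a function q : ℂ → ℂ and define, for each x ∈ ℂ, the polynomial Hamiltonian H(x, z, y) = z²·(z/108 − y²/72 + q(x)/6). Then for all x, z, y ∈ ℂ the partial derivatives of H in z and y (i.e. the derivatives of the one-variable functions z ↦ H(x,z,y) and y ↦ H(x,z,y)) satisfy 36·∂H/∂z(x,z,y) = z·(−y² + z + 12q(x)) and −36·∂H/∂y(x,z,y) = z·(y·z). Consequently, if y, z : ℂ → ℂ are differentiable on a nonempty open set U ⊆ ℂ, satisfy system IX.B(2) with coefficient q on U, and z(x) ≠ 0 for all x ∈ U, then y'(x) = (36/z(x))·∂H/∂z(x, z(x), y(x)) and z'(x) = −(36/z(x))·∂H/∂y(x, z(x), y(x)) for all x ∈ U;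 that is, system IX.B(2) is Hamiltonian with respect to the nonstandard 2-form (z/36)·dz∧dy with Hamiltonian H_Bu92 = H. -/
/-- The Hamiltonian H(x,z,y) = z²(z/108 - y²/72 + q(x)/6) satisfies
36·∂H/∂z = z·(-y² + z + 12q) and -36·∂H/∂y = z·(y·z); consequently system
IX.B(2) is Hamiltonian with respect to the nonstandard 2-form (z/36)·dz∧dy. -/
theorem systemIXB2_hamiltonian
    (q : ℂ → ℂ) (H : ℂ → ℂ → ℂ → ℂ)
    (hH : ∀ x z y : ℂ, H x z y = z ^ 2 * (z / 108 - y ^ 2 / 72 + q x / 6)) :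
    (∀ x z y : ℂ,
        36 * deriv (fun s => H x s y) z = z * (-y ^ 2 + z + 12 * q x) ∧
        -36 * deriv (fun s => H x z s) y = z * (y * z)) ∧
    (∀ (U : Set ℂ), IsOpen U → U.Nonempty → ∀ y z : ℂ → ℂ,
        (∀ x ∈ U, HasDerivAt y (-(y x) ^ 2 + z x + 12 * q x) x) →
        (∀ x ∈ U, HasDerivAt z (y x * z x) x) →
        (∀ x ∈ U, z x ≠ 0) →
        ∀ x ∈ U,
          HasDerivAt y (36 / z x * deriv (fun s => H x s (y x)) (z x)) x ∧
          HasDerivAt z (-(36 / z x) * deriv (fun s => H x (z x) s) (y x)) x) := by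
  have deriv_z (x z y : ℂ) :
      deriv (fun s => H x s y) z = z * (-y ^ 2 + z + 12 * q x) / 36 := by
    simp only [hH]
    have h := ((hasDerivAt_id z).pow 2).mul
      ((((hasDerivAt_id z).div_const 108).sub_const (y ^ 2 / 72)).add_const (q x / 6))
    refine (h.congr_deriv ?_).deriv
    simp
    ring
  have deriv_y (x z y : ℂ) : deriv (fun s => H x z s) y = -(z * (y * z)) / 36 := by
    simp only [hH]
    have h := (((((hasDerivAt_id y).pow 2).div_const 72).const_sub (z / 108)).add_const
      (q x / 6)).const_mul (z ^ 2)
    refine (h.congr_deriv ?_).deriv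
    simp
    ring
  refine ⟨fun x z y => ⟨?_, ?_⟩, fun U _ _ y z hy hz hz0 x hx => ⟨?_, ?_⟩⟩
  · rw [deriv_z]
    ring
  · rw [deriv_y]
    ring
  · have hzx := hz0 x hx
    refine (hy x hx).congr_deriv ?_
    rw [deriv_z]
    field_simp
  · have hzx := hz0 x hx
    refine (hz x hx).congr_deriv ?_
    rw [deriv_y]
    field_simp
end

section
/- Let U ⊆ ℂ be a nonempty open set and let q : ℂ → ℂ be twice differentiable on U with q''(x) = 6q(x)² + x for all x ∈ U. Suppose y, z : ℂ → ℂ are differentiable on U and satisfy system IX.B(5) with coefficient q on U, i.e. y' = −y² + z + 3q and z' = 4y·z − 9q'. Then the functions Y := −2q + y² − z/3 and Z := 6q·y − 2y³ + (2/3)y·z + q' are differentiable on U and satisfy system V on U, i.e. Y' = Z and Z' = 6Y² + x. -/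
/-- Solutions of system IX.B(5) with P_I coefficient q map to
solutions of system V via Y = -2q + y² - z/3, Z = 6q·y - 2y³ + (2/3)y·z + q'. -/
theorem systemIXB5_to_systemV
    (U : Set ℂ) (hU : IsOpen U) (hne : U.Nonempty)
    (q q' : ℂ → ℂ)
    (hq : ∀ x ∈ U, HasDerivAt q (q' x) x)
    (hq' : ∀ x ∈ U, HasDerivAt q' (6 * q x ^ 2 + x) x)
    (y z : ℂ → ℂ)
    (hy : ∀ x ∈ U, HasDerivAt y (-(y x) ^ 2 + z x + 3 * q x) x)
    (hz : ∀ x ∈ U, HasDerivAt z (4 * y x * z x - 9 * q' x) x) :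
    ∀ x ∈ U,
      HasDerivAt (fun s => -2 * q s + y s ^ 2 - z s / 3)
        (6 * q x * y x - 2 * y x ^ 3 + (2 / 3) * y x * z x + q' x) x ∧
      HasDerivAt (fun s => 6 * q s * y s - 2 * y s ^ 3 + (2 / 3) * y s * z s + q' s)
        (6 * (-2 * q x + y x ^ 2 - z x / 3) ^ 2 + x) x := by
  intro x hx
  have hqx := hq x hx
  have hyx := hy x hx
  have hzx := hz x hx
  constructor
  · refine (((hqx.const_mul (-2)).fun_add (hyx.fun_pow 2)).fun_sub
      (hzx.div_const 3)).congr_deriv ?_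
    push_cast
    ring
  · refine (((((hqx.const_mul 6).fun_mul hyx).fun_sub ((hyx.fun_pow 3).const_mul 2)).fun_add
      ((hyx.const_mul (2 / 3)).fun_mul hzx)).fun_add (hq' x hx)).congr_deriv ?_
    push_cast
    ring
end

section
/- Let U ⊆ ℂ be a nonempty open set and let q : ℂ → ℂ be twice differentiable on U with q''(x) = 6q(x)² + x for all x ∈ U. Suppose y, z : ℂ → ℂ are differentiable on U, satisfy system V on U, i.e. y' = z and z' = 6y² + x, and that y(x) ≠ q(x) for every x ∈ U. Then the functions Y := −(z − q')/(2(y − q)) and Z := −9q − 3(y − q) + 3(z − q')²/(4(y − q)²) are differentiable on U and satisfy system IX.B(5) with coefficient q on U, i.e. Y' = −Y² + Z + 3q and Z' = 4Y·Z − 9q'. -/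
/-- Solutions of system V (with y ≠ q on U) map to solutions of
system IX.B(5) via Y = -(z - q')/(2(y - q)),
Z = -9q - 3(y - q) + 3(z - q')²/(4(y - q)²). -/
theorem systemV_to_systemIXB5
    (U : Set ℂ) (hU : IsOpen U) (hne : U.Nonempty)
    (q q' : ℂ → ℂ)
    (hq : ∀ x ∈ U, HasDerivAt q (q' x) x)
    (hq' : ∀ x ∈ U, HasDerivAt q' (6 * q x ^ 2 + x) x)
    (y z : ℂ → ℂ)
    (hy : ∀ x ∈ U, HasDerivAt y (z x) x)
    (hz : ∀ x ∈ U, HasDerivAt z (6 * y x ^ 2 + x) x)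
    (hne' : ∀ x ∈ U, y x ≠ q x) :
    ∀ x ∈ U,
      HasDerivAt (fun s => -(z s - q' s) / (2 * (y s - q s)))
        (-(-(z x - q' x) / (2 * (y x - q x))) ^ 2 +
          (-9 * q x - 3 * (y x - q x) + 3 * (z x - q' x) ^ 2 / (4 * (y x - q x) ^ 2)) +
          3 * q x) x ∧
      HasDerivAt
        (fun s => -9 * q s - 3 * (y s - q s) + 3 * (z s - q' s) ^ 2 / (4 * (y s - q s) ^ 2))
        (4 * (-(z x - q' x) / (2 * (y x - q x))) *
          (-9 * q x - 3 * (y x - q x) + 3 * (z x - q' x) ^ 2 / (4 * (y x - q x) ^ 2)) -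
          9 * q' x) x := by
  intro x hx
  have hu : y x - q x ≠ 0 := sub_ne_zero.mpr (hne' x hx)
  have hdu : HasDerivAt (fun s => y s - q s) (z x - q' x) x := (hy x hx).fun_sub (hq x hx)
  have hdw : HasDerivAt (fun s => z s - q' s) (6 * y x ^ 2 + x - (6 * q x ^ 2 + x)) x :=
    (hz x hx).fun_sub (hq' x hx)
  have hv : 4 * (y x - q x) ^ 2 ≠ 0 := mul_ne_zero (by norm_num) (pow_ne_zero 2 hu)
  constructor
  · refine (hdw.fun_neg.fun_div (hdu.const_mul 2) (mul_ne_zero two_ne_zero hu)).congr_deriv ?_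
    field_simp
    ring
  · refine ((((hq x hx).const_mul (-9)).fun_sub (hdu.const_mul 3)).fun_add
      (((hdw.fun_pow 2).const_mul 3).fun_div ((hdu.fun_pow 2).const_mul 4) hv)).congr_deriv ?_
    field_simp
    ring
end

section
/- Let U ⊆ ℂ be a nonempty open set, let p, r : ℂ → ℂ be differentiable on U with r' = p·r on U, and define q := (p' + p² − r)/12; assume q is twice differentiable on U and q''(x) = 6q(x)² + x for all x ∈ U. Suppose y, z : ℂ → ℂ are differentiable on U and satisfy system XIV with coefficients p, r on U, i.e. y' = y(2z − y) + 3py + r and z' = z(y − z) − 2pz. Then the functions Y := (6q + r + y·z)/6 and Z := (r·z + y·z² + 6q' + p·(r + y·z))/6 are differentiable on U and satisfy system V on U, i.e. Y' = Z and Z' = 6Y² + x. -/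
/-- Solutions of system XIV with coefficients p, r (where r' = p·r,
q = (p' + p² - r)/12 satisfies P_I) map to solutions of system V via
Y = (6q + r + y·z)/6, Z = (r·z + y·z² + 6q' + p(r + y·z))/6. -/
theorem systemXIV_to_systemV
    (U : Set ℂ) (hU : IsOpen U) (hne : U.Nonempty)
    (p p' r q q' : ℂ → ℂ)
    (hp : ∀ x ∈ U, HasDerivAt p (p' x) x)
    (hr : ∀ x ∈ U, HasDerivAt r (p x * r x) x)
    (hqdef : ∀ x : ℂ, q x = (p' x + p x ^ 2 - r x) / 12)
    (hq : ∀ x ∈ U, HasDerivAt q (q' x) x)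
    (hq' : ∀ x ∈ U, HasDerivAt q' (6 * q x ^ 2 + x) x)
    (y z : ℂ → ℂ)
    (hy : ∀ x ∈ U, HasDerivAt y (y x * (2 * z x - y x) + 3 * p x * y x + r x) x)
    (hz : ∀ x ∈ U, HasDerivAt z (z x * (y x - z x) - 2 * p x * z x) x) :
    ∀ x ∈ U,
      HasDerivAt (fun s => (6 * q s + r s + y s * z s) / 6)
        ((r x * z x + y x * z x ^ 2 + 6 * q' x + p x * (r x + y x * z x)) / 6) x ∧
      HasDerivAt (fun s => (r s * z s + y s * z s ^ 2 + 6 * q' s + p s * (r s + y s * z s)) / 6)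
        (6 * ((6 * q x + r x + y x * z x) / 6) ^ 2 + x) x := by
  intro x hx
  have hp' : p' x = 12 * q x - p x ^ 2 + r x := by
    rw [hqdef x]
    ring
  have hyz := (hy x hx).mul (hz x hx)
  refine ⟨?_, ?_⟩
  · refine (((((hq x hx).const_mul 6).add (hr x hx)).add hyz).div_const 6).congr_deriv ?_
    ring
  · refine ((((((hr x hx).mul (hz x hx)).add ((hy x hx).mul ((hz x hx).pow 2))).add
      ((hq' x hx).const_mul 6)).add ((hp x hx).mul ((hr x hx).add hyz))).div_const 6).congr_deriv ?_
    simp only [Pi.add_apply, Pi.mul_apply, Pi.pow_apply, hp']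
    push_cast
    ring
end

section
/- Let U ⊆ ℂ be a nonempty open set, let p, r : ℂ → ℂ be differentiable on U with r' = p·r on U, and define q := (p' + p² − r)/12; assume q is twice differentiable on U and q''(x) = 6q(x)² + x for all x ∈ U. Suppose y, z : ℂ → ℂ are differentiable on U, satisfy system V on U, i.e. y' = z and z' = 6y² + x, and that for every x ∈ U one has y(x) ≠ q(x) and q(x)p(x) − p(x)y(x) + z(x) − q'(x) ≠ 0. Then the functions Y := (6q + r − 6y)(q − y)/(qp − py + z − q') and Z := (z − q')/(y − q) − p are differentiable on U and satisfy system XIV with coefficients p, r on U, i.e. Y' = Y(2Z − Y) + 3pY + r and Z' = Z(Y − Z) − 2pZ. -/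
/-- Solutions of system V (with nonvanishing denominators) map to
solutions of system XIV via Y = (6q + r - 6y)(q - y)/(qp - py + z - q'),
Z = (z - q')/(y - q) - p. -/
theorem systemV_to_systemXIV
    (U : Set ℂ) (hU : IsOpen U) (hne : U.Nonempty)
    (p p' r q q' : ℂ → ℂ)
    (hp : ∀ x ∈ U, HasDerivAt p (p' x) x)
    (hr : ∀ x ∈ U, HasDerivAt r (p x * r x) x)
    (hqdef : ∀ x : ℂ, q x = (p' x + p x ^ 2 - r x) / 12)
    (hq : ∀ x ∈ U, HasDerivAt q (q' x) x)
    (hq' : ∀ x ∈ U, HasDerivAt q' (6 * q x ^ 2 + x) x)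
    (y z : ℂ → ℂ)
    (hy : ∀ x ∈ U, HasDerivAt y (z x) x)
    (hz : ∀ x ∈ U, HasDerivAt z (6 * y x ^ 2 + x) x)
    (hne1 : ∀ x ∈ U, y x ≠ q x)
    (hne2 : ∀ x ∈ U, q x * p x - p x * y x + z x - q' x ≠ 0) :
    ∀ x ∈ U,
      HasDerivAt
        (fun s => (6 * q s + r s - 6 * y s) * (q s - y s) / (q s * p s - p s * y s + z s - q' s))
        (((6 * q x + r x - 6 * y x) * (q x - y x) / (q x * p x - p x * y x + z x - q' x)) *
            (2 * ((z x - q' x) / (y x - q x) - p x) -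
              (6 * q x + r x - 6 * y x) * (q x - y x) / (q x * p x - p x * y x + z x - q' x)) +
          3 * p x *
            ((6 * q x + r x - 6 * y x) * (q x - y x) / (q x * p x - p x * y x + z x - q' x)) +
          r x) x ∧
      HasDerivAt (fun s => (z s - q' s) / (y s - q s) - p s)
        (((z x - q' x) / (y x - q x) - p x) *
            ((6 * q x + r x - 6 * y x) * (q x - y x) / (q x * p x - p x * y x + z x - q' x) -
              ((z x - q' x) / (y x - q x) - p x)) -
          2 * p x * ((z x - q' x) / (y x - q x) - p x)) x := by
  intro x hx
  have hu : y x - q x ≠ 0 := sub_ne_zero.mpr (hne1 x hx)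
  have hD := hne2 x hx
  have hD' : p x * (q x - y x) + z x - q' x ≠ 0 := by
    convert hD using 1
    ring
  have hp' : p' x = 12 * q x - p x ^ 2 + r x := by
    rw [hqdef x]
    ring
  have dp := hp x hx
  rw [hp'] at dp
  have dq := hq x hx
  have dr := hr x hx
  have dy := hy x hx
  have dv := (hz x hx).sub (hq' x hx)
  constructor
  · have dN := (((dq.const_mul 6).add dr).sub (dy.const_mul 6)).mul (dq.sub dy)
    have dD := (((dq.mul dp).sub (dp.mul dy)).add (hz x hx)).sub (hq' x hx)
    refine (dN.div dD hD).congr_deriv ?_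
    simp only [Pi.add_apply, Pi.sub_apply, Pi.mul_apply]
    field_simp
    ring
  · refine ((dv.div (dy.sub dq) hu).sub dp).congr_deriv ?_
    simp only [Pi.sub_apply]
    field_simp
    ring
end

section
/- Let U ⊆ ℂ be a nonempty open set, let p, r : ℂ → ℂ be functions with p twice differentiable and r differentiable on U, satisfying r' = p·r on U, and define q := (p' + p² − r)/12. Suppose y, z : ℂ → ℂ are differentiable on U and satisfy system XIV with coefficients p, r on U, i.e. y' = y(2z − y) + 3py + r and z' = z(y − z) − 2pz. Then the function u := z + p is twice differentiable on U and satisfies u'' = −u·u' + u³ − 12q·u + 12q' on U. -/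
/-- For a solution of system XIV, the function u = z + p is twice
differentiable and satisfies u'' = -u·u' + u³ - 12q·u + 12q'. -/
theorem systemXIV_second_order
    (U : Set ℂ) (hU : IsOpen U) (hne : U.Nonempty)
    (p p' p'' r q q' : ℂ → ℂ)
    (hp : ∀ x ∈ U, HasDerivAt p (p' x) x)
    (hp' : ∀ x ∈ U, HasDerivAt p' (p'' x) x)
    (hr : ∀ x ∈ U, HasDerivAt r (p x * r x) x)
    (hqdef : ∀ x : ℂ, q x = (p' x + p x ^ 2 - r x) / 12)
    (hq : ∀ x ∈ U, HasDerivAt q (q' x) x)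
    (y z : ℂ → ℂ)
    (hy : ∀ x ∈ U, HasDerivAt y (y x * (2 * z x - y x) + 3 * p x * y x + r x) x)
    (hz : ∀ x ∈ U, HasDerivAt z (z x * (y x - z x) - 2 * p x * z x) x) :
    ∀ x ∈ U,
      HasDerivAt (fun s => z s + p s)
        (z x * (y x - z x) - 2 * p x * z x + p' x) x ∧
      HasDerivAt (fun s => z s * (y s - z s) - 2 * p s * z s + p' s)
        (-(z x + p x) * (z x * (y x - z x) - 2 * p x * z x + p' x) + (z x + p x) ^ 3 -
          12 * q x * (z x + p x) + 12 * q' x) x := by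
  intro x hx
  have hq_eq : q = fun s => (p' s + p s ^ 2 - r s) / 12 := funext hqdef
  have hq'_eq : q' x = (p'' x + 2 * p x * p' x - p x * r x) / 12 := by
    refine (hq x hx).unique ?_
    rw [hq_eq]
    refine ((((hp' x hx).fun_add ((hp x hx).fun_pow 2)).fun_sub (hr x hx)).div_const 12).congr_deriv ?_
    norm_num
  refine ⟨(hz x hx).fun_add (hp x hx), ?_⟩
  refine ((((hz x hx).fun_mul ((hy x hx).fun_sub (hz x hx))).fun_sub
    (((hp x hx).const_mul 2).fun_mul (hz x hx))).fun_add (hp' x hx)).congr_deriv ?_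
  rw [hq'_eq, hqdef x]
  ring
end

section
/- Let U ⊆ ℂ be a nonempty open set, let α ∈ ℂ, and let p : ℂ → ℂ be twice differentiable on U with p''(x) = 2p(x)³ + x·p(x) + α for all x ∈ U. Suppose y, z : ℂ → ℂ are differentiable on U and satisfy system XIII with f(x) = x and coefficient p on U, i.e. y' = (1/2)y(2z − y) + 2py and z' = (1/2)z(3y − 2z) − 4pz + 2p² − 2p' + x. Then the functions Y := (2p − y)/2 and Z := (1/2)(y² − y·z − 4p·y + x + 2p² + 2p') are differentiable on U and satisfy system IX.B(3) with parameter α on U, i.e. Y' = −Y² + Z − x/2 and Z' = 2Y·Z + (2α+1)/2. -/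
/-- Solutions of system XIII (f(x)=x, coefficient p satisfying
P_II with parameter α) map to solutions of system IX.B(3) via Y = (2p - y)/2,
Z = (1/2)(y² - y·z - 4p·y + x + 2p² + 2p'). -/
theorem systemXIII_to_systemIXB3
    (U : Set ℂ) (hU : IsOpen U) (hne : U.Nonempty) (α : ℂ)
    (p p' : ℂ → ℂ)
    (hp : ∀ x ∈ U, HasDerivAt p (p' x) x)
    (hp' : ∀ x ∈ U, HasDerivAt p' (2 * p x ^ 3 + x * p x + α) x)
    (y z : ℂ → ℂ)
    (hy : ∀ x ∈ U, HasDerivAt y ((1 / 2) * y x * (2 * z x - y x) + 2 * p x * y x) x)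
    (hz : ∀ x ∈ U, HasDerivAt z
      ((1 / 2) * z x * (3 * y x - 2 * z x) - 4 * p x * z x + 2 * p x ^ 2 - 2 * p' x + x) x) :
    ∀ x ∈ U,
      HasDerivAt (fun s => (2 * p s - y s) / 2)
        (-((2 * p x - y x) / 2) ^ 2 +
          (1 / 2) * (y x ^ 2 - y x * z x - 4 * p x * y x + x + 2 * p x ^ 2 + 2 * p' x) -
          x / 2) x ∧
      HasDerivAt
        (fun s => (1 / 2) * (y s ^ 2 - y s * z s - 4 * p s * y s + s + 2 * p s ^ 2 + 2 * p' s))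
        (2 * ((2 * p x - y x) / 2) *
          ((1 / 2) * (y x ^ 2 - y x * z x - 4 * p x * y x + x + 2 * p x ^ 2 + 2 * p' x)) +
          (2 * α + 1) / 2) x := by
  intro x hx
  have hpx := hp x hx
  have hyx := hy x hx
  constructor
  · refine (((hpx.const_mul 2).sub hyx).div_const 2).congr_deriv ?_
    ring
  · refine ((((((hyx.pow 2).sub (hyx.mul (hz x hx))).sub ((hpx.const_mul 4).mul hyx)).add
      (hasDerivAt_id x)).add ((hpx.pow 2).const_mul 2)).add
      ((hp' x hx).const_mul 2)).const_mul (1 / 2) |>.congr_deriv ?_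
    norm_num
    ring
end

section
/- Let U ⊆ ℂ be a nonempty open set, let α ∈ ℂ, and let p : ℂ → ℂ be twice differentiable on U with p''(x) = 2p(x)³ + x·p(x) + α for all x ∈ U. Suppose y, z : ℂ → ℂ are differentiable on U, satisfy system IX.B(3) with parameter α on U, i.e. y' = −y² + z − x/2 and z' = 2y·z + (2α+1)/2, and that p(x) ≠ y(x) for every x ∈ U. Then the functions Y := 2p − 2y and Z := (2(x + 2y² − z) + 2p' − 2p² − x)/(2p − 2y) are differentiable on U and satisfy system XIII with f(x) = x and coefficient p on U, i.e. Y' = (1/2)Y(2Z − Y) + 2pY and Z' = (1/2)Z(3Y − 2Z) − 4pZ + 2p² − 2p' + x. -/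
/-- Solutions of system IX.B(3) with parameter α (with p ≠ y on U,
p satisfying P_II with parameter α) map to solutions of system XIII (f(x)=x) via
Y = 2p - 2y, Z = (2(x + 2y² - z) + 2p' - 2p² - x)/(2p - 2y). -/
theorem systemIXB3_to_systemXIII
    (U : Set ℂ) (hU : IsOpen U) (hne : U.Nonempty) (α : ℂ)
    (p p' : ℂ → ℂ)
    (hp : ∀ x ∈ U, HasDerivAt p (p' x) x)
    (hp' : ∀ x ∈ U, HasDerivAt p' (2 * p x ^ 3 + x * p x + α) x)
    (y z : ℂ → ℂ)
    (hy : ∀ x ∈ U, HasDerivAt y (-(y x) ^ 2 + z x - x / 2) x)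
    (hz : ∀ x ∈ U, HasDerivAt z (2 * y x * z x + (2 * α + 1) / 2) x)
    (hne' : ∀ x ∈ U, p x ≠ y x) :
    ∀ x ∈ U,
      HasDerivAt (fun s => 2 * p s - 2 * y s)
        ((1 / 2) * (2 * p x - 2 * y x) *
            (2 * ((2 * (x + 2 * y x ^ 2 - z x) + 2 * p' x - 2 * p x ^ 2 - x) /
                (2 * p x - 2 * y x)) -
              (2 * p x - 2 * y x)) +
          2 * p x * (2 * p x - 2 * y x)) x ∧
      HasDerivAt
        (fun s => (2 * (s + 2 * y s ^ 2 - z s) + 2 * p' s - 2 * p s ^ 2 - s) /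
          (2 * p s - 2 * y s))
        ((1 / 2) *
            ((2 * (x + 2 * y x ^ 2 - z x) + 2 * p' x - 2 * p x ^ 2 - x) / (2 * p x - 2 * y x)) *
            (3 * (2 * p x - 2 * y x) -
              2 * ((2 * (x + 2 * y x ^ 2 - z x) + 2 * p' x - 2 * p x ^ 2 - x) /
                (2 * p x - 2 * y x))) -
          4 * p x *
            ((2 * (x + 2 * y x ^ 2 - z x) + 2 * p' x - 2 * p x ^ 2 - x) / (2 * p x - 2 * y x)) +
          2 * p x ^ 2 - 2 * p' x + x) x := by
  intro x hx
  have hpy : p x - y x ≠ 0 := sub_ne_zero.mpr (hne' x hx)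
  have hY : 2 * p x - 2 * y x ≠ 0 := by
    rw [← mul_sub]
    exact mul_ne_zero two_ne_zero hpy
  have hdY := ((hp x hx).const_mul 2).sub ((hy x hx).const_mul 2)
  have hdN := ((((((hasDerivAt_id' x).add (((hy x hx).fun_pow 2).const_mul 2)).sub
    (hz x hx)).const_mul 2).add ((hp' x hx).const_mul 2)).sub
    (((hp x hx).fun_pow 2).const_mul 2)).sub (hasDerivAt_id' x)
  constructor
  · refine hdY.congr_deriv ?_
    field_simp
    ring
  · refine (hdN.div hdY hY).congr_deriv ?_
    simp only [Pi.add_apply, Pi.sub_apply]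
    field_simp
    ring
end

section
/- Let U ⊆ ℂ be a nonempty open set, let α ∈ ℂ, and let p : ℂ → ℂ be twice differentiable on U with p''(x) = 2p(x)³ + x·p(x) − α for all x ∈ U (i.e. p satisfies P_II with parameter −α). Suppose y, z : ℂ → ℂ are differentiable on U and satisfy system XIII with f(x) = x and coefficient p on U, i.e. y' = (1/2)y(2z − y) + 2py and z' = (1/2)z(3y − 2z) − 4pz + 2p² − 2p' + x. Then the functions Y := y/2 − p and Z := (1/2)(y·z + x + 2p² − 2p') are differentiable on U and satisfy system IX.B(3) with parameter α on U, i.e. Y' = −Y² + Z − x/2 and Z' = 2Y·Z + (2α+1)/2. -/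
/-- Solutions of system XIII (f(x)=x, p satisfying P_II with
parameter -α) map to solutions of system IX.B(3) with parameter α via
Y = y/2 - p, Z = (1/2)(y·z + x + 2p² - 2p'). -/
theorem systemXIII_to_systemIXB3_alt
    (U : Set ℂ) (hU : IsOpen U) (hne : U.Nonempty) (α : ℂ)
    (p p' : ℂ → ℂ)
    (hp : ∀ x ∈ U, HasDerivAt p (p' x) x)
    (hp' : ∀ x ∈ U, HasDerivAt p' (2 * p x ^ 3 + x * p x - α) x)
    (y z : ℂ → ℂ)
    (hy : ∀ x ∈ U, HasDerivAt y ((1 / 2) * y x * (2 * z x - y x) + 2 * p x * y x) x)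
    (hz : ∀ x ∈ U, HasDerivAt z
      ((1 / 2) * z x * (3 * y x - 2 * z x) - 4 * p x * z x + 2 * p x ^ 2 - 2 * p' x + x) x) :
    ∀ x ∈ U,
      HasDerivAt (fun s => y s / 2 - p s)
        (-(y x / 2 - p x) ^ 2 +
          (1 / 2) * (y x * z x + x + 2 * p x ^ 2 - 2 * p' x) - x / 2) x ∧
      HasDerivAt (fun s => (1 / 2) * (y s * z s + s + 2 * p s ^ 2 - 2 * p' s))
        (2 * (y x / 2 - p x) * ((1 / 2) * (y x * z x + x + 2 * p x ^ 2 - 2 * p' x)) +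
          (2 * α + 1) / 2) x := by
  intro x hx
  have hpx := hp x hx
  have hyx := hy x hx
  constructor
  · refine ((hyx.div_const 2).sub hpx).congr_deriv ?_
    ring
  · refine (((((hyx.mul (hz x hx)).add (hasDerivAt_id' x)).add
      ((hpx.pow 2).const_mul 2)).sub ((hp' x hx).const_mul 2)).const_mul (1 / 2)).congr_deriv ?_
    push_cast
    ring
end

section
/- Fix a differentiable function p : ℂ → ℂ and define, for each x ∈ ℂ, the polynomial Hamiltonian H(x, z, y) = (y²/2)·(p(x)² − p'(x) − 2p(x)·z + (y·z − z² + x)/2). Then for all x, z, y ∈ ℂ the partial derivatives of H in z and y satisfy −2·∂H/∂z(x,z,y) = y·((1/2)y(2z − y) + 2p(x)y) and 2·∂H/∂y(x,z,y) = y·((1/2)z(3y − 2z) − 4p(x)z + 2p(x)² − 2p'(x) + x). Consequently, if y, z : ℂ → ℂ are differentiable on a nonempty open set U ⊆ ℂ, satisfy system XIII with f(x) = x and coefficient p on U, and y(x) ≠ 0 for all x ∈ U, then y'(x) = −(2/y(x))·∂H/∂z(x, z(x), y(x)) and z'(x) = (2/y(x))·∂H/∂y(x, z(x), y(x)) for all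 x ∈ U; that is, system XIII is Hamiltonian with respect to the nonstandard 2-form −(y/2)·dz∧dy with Hamiltonian H_Bu13 = H. -/
/-- The `z`-derivative of `(y²/2)(a - 2bz + (yz - z² + c)/2)`. -/
theorem hasDerivAt_hamiltonian_z (a b c y z : ℂ) :
    HasDerivAt (fun s : ℂ => (y ^ 2 / 2) * (a - 2 * b * s + (y * s - s ^ 2 + c) / 2))
      ((y ^ 2 / 2) * (-(2 * b) + (y - 2 * z) / 2)) z := by
  have hs := hasDerivAt_id' z
  refine ((((hs.const_mul (2 * b)).const_sub a).add
    ((((hs.const_mul y).sub (hs.pow 2)).add_const c).div_const 2)).const_mul (y ^ 2 / 2)).congr_deriv ?_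
  norm_num

/-- The `y`-derivative of `(y²/2)(a - 2bz + (yz - z² + c)/2)`. -/
theorem hasDerivAt_hamiltonian_y (a b c y z : ℂ) :
    HasDerivAt (fun s : ℂ => (s ^ 2 / 2) * (a - 2 * b * z + (s * z - z ^ 2 + c) / 2))
      (y * (a - 2 * b * z + (y * z - z ^ 2 + c) / 2) + (y ^ 2 / 2) * (z / 2)) y := by
  have hs := hasDerivAt_id' y
  refine (((hs.pow 2).div_const 2).mul
    (((((hs.mul_const z).sub_const (z ^ 2)).add_const c).div_const 2).const_add
      (a - 2 * b * z))).congr_deriv ?_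
  simp only [Pi.pow_apply]
  push_cast
  ring

/-- The Hamiltonian H(x,z,y) = (y²/2)(p² - p' - 2pz + (yz - z² + x)/2)
satisfies -2·∂H/∂z = y·((1/2)y(2z-y) + 2py) and
2·∂H/∂y = y·((1/2)z(3y-2z) - 4pz + 2p² - 2p' + x); consequently system XIII
(with f(x)=x) is Hamiltonian with respect to the nonstandard 2-form -(y/2)·dz∧dy. -/
theorem systemXIII_hamiltonian
    (p p' : ℂ → ℂ) (hp : ∀ x : ℂ, HasDerivAt p (p' x) x)
    (H : ℂ → ℂ → ℂ → ℂ)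
    (hH : ∀ x z y : ℂ, H x z y =
      (y ^ 2 / 2) * (p x ^ 2 - p' x - 2 * p x * z + (y * z - z ^ 2 + x) / 2)) :
    (∀ x z y : ℂ,
        -2 * deriv (fun s => H x s y) z = y * ((1 / 2) * y * (2 * z - y) + 2 * p x * y) ∧
        2 * deriv (fun s => H x z s) y =
          y * ((1 / 2) * z * (3 * y - 2 * z) - 4 * p x * z + 2 * p x ^ 2 - 2 * p' x + x)) ∧
    (∀ (U : Set ℂ), IsOpen U → U.Nonempty → ∀ y z : ℂ → ℂ,
        (∀ x ∈ U, HasDerivAt y ((1 / 2) * y x * (2 * z x - y x) + 2 * p x * y x) x) →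
        (∀ x ∈ U, HasDerivAt z
          ((1 / 2) * z x * (3 * y x - 2 * z x) - 4 * p x * z x + 2 * p x ^ 2 - 2 * p' x + x) x) →
        (∀ x ∈ U, y x ≠ 0) →
        ∀ x ∈ U,
          HasDerivAt y (-(2 / y x) * deriv (fun s => H x s (y x)) (z x)) x ∧
          HasDerivAt z ((2 / y x) * deriv (fun s => H x (z x) s) (y x)) x) := by
  have partials : ∀ x z y : ℂ,
      -2 * deriv (fun s => H x s y) z = y * ((1 / 2) * y * (2 * z - y) + 2 * p x * y) ∧
      2 * deriv (fun s => H x z s) y =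
        y * ((1 / 2) * z * (3 * y - 2 * z) - 4 * p x * z + 2 * p x ^ 2 - 2 * p' x + x) := by
    intro x z y
    simp only [hH]
    rw [(hasDerivAt_hamiltonian_z (p x ^ 2 - p' x) (p x) x y z).deriv,
      (hasDerivAt_hamiltonian_y (p x ^ 2 - p' x) (p x) x y z).deriv]
    constructor <;> ring
  refine ⟨partials, fun U _ _ y z hy hz hne x hx => ?_⟩
  obtain ⟨hHz, hHy⟩ := partials x (z x) (y x)
  have hyx := hne x hx
  constructor
  · convert hy x hx using 1
    apply mul_left_cancel₀ hyx
    rw [← hHz]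
    field_simp
  · convert hz x hx using 1
    apply mul_left_cancel₀ hyx
    rw [← hHy]
    field_simp
end

section
/- Let U ⊆ ℂ be a nonempty open set, let f : ℂ → ℂ be differentiable on U and let p : ℂ → ℂ be twice differentiable on U. Suppose y, z : ℂ → ℂ are differentiable on U and satisfy system XIII with coefficients f, p on U, i.e. y' = (1/2)y(2z − y) + 2py and z' = (1/2)z(3y − 2z) − 4pz + 2p² − 2p' + f. Then the functions w := y and t := f + 2p² + y·z − 2p' are differentiable on U and satisfy the intermediate Hamiltonian system on U: w' = (1/2)(4pw + 2t − w² + 4p' − 4p² − 2f) and t' = (w − 2p)·t + f' − 2p'' + 2f·p + 4p³. -/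
/-- Solutions of system XIII with coefficients f, p map to
solutions of the intermediate Hamiltonian system via w = y,
t = f + 2p² + y·z - 2p'. -/
theorem systemXIII_to_intermediate
    (U : Set ℂ) (hU : IsOpen U) (hne : U.Nonempty)
    (f f' p p' p'' : ℂ → ℂ)
    (hf : ∀ x ∈ U, HasDerivAt f (f' x) x)
    (hp : ∀ x ∈ U, HasDerivAt p (p' x) x)
    (hp' : ∀ x ∈ U, HasDerivAt p' (p'' x) x)
    (y z : ℂ → ℂ)
    (hy : ∀ x ∈ U, HasDerivAt y ((1 / 2) * y x * (2 * z x - y x) + 2 * p x * y x) x)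
    (hz : ∀ x ∈ U, HasDerivAt z
      ((1 / 2) * z x * (3 * y x - 2 * z x) - 4 * p x * z x + 2 * p x ^ 2 - 2 * p' x + f x) x) :
    ∀ x ∈ U,
      HasDerivAt (fun s => y s)
        ((1 / 2) * (4 * p x * y x + 2 * (f x + 2 * p x ^ 2 + y x * z x - 2 * p' x) -
          y x ^ 2 + 4 * p' x - 4 * p x ^ 2 - 2 * f x)) x ∧
      HasDerivAt (fun s => f s + 2 * p s ^ 2 + y s * z s - 2 * p' s)
        ((y x - 2 * p x) * (f x + 2 * p x ^ 2 + y x * z x - 2 * p' x) + f' x - 2 * p'' x +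
          2 * f x * p x + 4 * p x ^ 3) x := by
  intro x hx
  refine ⟨(hy x hx).congr_deriv (by ring), ?_⟩
  refine ((((hf x hx).fun_add (((hp x hx).fun_pow 2).const_mul 2)).fun_add
    ((hy x hx).fun_mul (hz x hx))).fun_sub ((hp' x hx).const_mul 2)).congr_deriv ?_
  push_cast
  ring
end

section
/- Let U ⊆ ℂ be a nonempty open set, let α ∈ ℂ, let f : ℂ → ℂ be differentiable on U, and let p : ℂ → ℂ be twice differentiable on U with p''(x) = 2p(x)³ + f(x)·p(x) + α for all x ∈ U. Suppose w, t : ℂ → ℂ are differentiable on U and satisfy the intermediate Hamiltonian system with coefficients f, p on U, i.e. w' = (1/2)(4pw + 2t − w² + 4p' − 4p² − 2f) and t' = (w − 2p)·t + f' − 2p'' + 2f·p + 4p³. Then the functions W := p − w/2 and T := t − f + 2αx are differentiable on U and satisfy W'(x) = αx + W(x)² − T(x)/2 and T'(x) = −2W(x)·(T(x) + f(x) − 2αx) for all x ∈ U. -/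
/-- Solutions of the intermediate Hamiltonian system (with p
satisfying p'' = 2p³ + fp + α) map to solutions of the quadratic system via
W = p - w/2, T = t - f + 2αx. -/
theorem intermediate_to_quadratic
    (U : Set ℂ) (hU : IsOpen U) (hne : U.Nonempty) (α : ℂ)
    (f f' p p' p'' : ℂ → ℂ)
    (hf : ∀ x ∈ U, HasDerivAt f (f' x) x)
    (hp : ∀ x ∈ U, HasDerivAt p (p' x) x)
    (hp' : ∀ x ∈ U, HasDerivAt p' (p'' x) x)
    (hPII : ∀ x ∈ U, p'' x = 2 * p x ^ 3 + f x * p x + α)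
    (w t : ℂ → ℂ)
    (hw : ∀ x ∈ U, HasDerivAt w
      ((1 / 2) * (4 * p x * w x + 2 * t x - w x ^ 2 + 4 * p' x - 4 * p x ^ 2 - 2 * f x)) x)
    (ht : ∀ x ∈ U, HasDerivAt t
      ((w x - 2 * p x) * t x + f' x - 2 * p'' x + 2 * f x * p x + 4 * p x ^ 3) x) :
    ∀ x ∈ U,
      HasDerivAt (fun s => p s - w s / 2)
        (α * x + (p x - w x / 2) ^ 2 - (t x - f x + 2 * α * x) / 2) x ∧
      HasDerivAt (fun s => t s - f s + 2 * α * s)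
        (-2 * (p x - w x / 2) * ((t x - f x + 2 * α * x) + f x - 2 * α * x)) x := by
  intro x hx
  constructor
  · exact ((hp x hx).sub ((hw x hx).div_const 2)).congr_deriv (by ring)
  · refine (((ht x hx).sub (hf x hx)).add ((hasDerivAt_id' x).const_mul (2 * α))).congr_deriv ?_
    rw [hPII x hx]
    ring
end

section
/- Let U ⊆ ℂ be a nonempty open set and let α ∈ ℂ. Suppose w, t : ℂ → ℂ are differentiable on U and satisfy the quadratic system with f(x) = x on U, i.e. w'(x) = αx + w(x)² − t(x)/2 and t'(x) = −2w(x)·(t(x) + x − 2αx) for all x ∈ U. Then w is twice differentiable on U and satisfies the second Painlevé equation with parameter α: w''(x) = 2w(x)³ + x·w(x) + α for all x ∈ U. -/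
/-- For a solution of the quadratic system with f(x) = x, the
function w is twice differentiable and satisfies the second Painlevé equation
w'' = 2w³ + xw + α. -/
theorem quadratic_system_gives_PII
    (U : Set ℂ) (hU : IsOpen U) (hne : U.Nonempty) (α : ℂ)
    (w t : ℂ → ℂ)
    (hw : ∀ x ∈ U, HasDerivAt w (α * x + w x ^ 2 - t x / 2) x)
    (ht : ∀ x ∈ U, HasDerivAt t (-2 * w x * (t x + x - 2 * α * x)) x) :
    ∀ x ∈ U,
      HasDerivAt (fun s => α * s + w s ^ 2 - t s / 2)
        (2 * w x ^ 3 + x * w x + α) x := by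
  intro x hx
  have h := (((hasDerivAt_id' x).const_mul α).add ((hw x hx).pow 2)).sub ((ht x hx).div_const 2)
  refine h.congr_deriv ?_
  push_cast
  ring
end
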